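/- arXiv:1106.1072 — 2 statements merged into one kernel-verified Lean document; each statement's English description precedes it below -/
import Mathlib

section
/- Let k be a field and A a bialgebra over k with comultiplication Δ, and let p, q : A → k be k-algebra homomorphisms with p ⋆ q := (p ⊗ q) ∘ Δ. Let a, b ≥ 1 be integers and let φ, ψ : A → k be k-linear functionals such that φ vanishes on (ker p)^a and ψ vanishes on (ker q)^b. Then the convolution φ ⋆ ψ := (φ ⊗ ψ) ∘ Δ vanishes on (ker (p ⋆ q))^{a+b-1}. -/
/-!
STATEMENT 3: For a bialgebra `A` over a field `k`, algebra homomorphisms `p q : A → k`,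
and linear functionals `φ, ψ` vanishing on `(ker p)^a` and `(ker q)^b` respectively
(`a, b ≥ 1`), the convolution `φ ⋆ ψ := (φ ⊗ ψ) ∘ Δ` vanishes on `(ker (p ⋆ q))^{a+b-1}`.
-/

open TensorProduct

variable {k A : Type*} [Field k] [Ring A] [Bialgebra k A]

/-- The convolution product `φ ⋆ ψ := (φ ⊗ ψ) ∘ Δ` on linear functionals on `A`. -/
noncomputable def convMul (φ ψ : A →ₗ[k] k) : A →ₗ[k] k :=
  LinearMap.mul' k k ∘ₗ TensorProduct.map φ ψ ∘ₗ Coalgebra.comul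

section TensorSquare

variable {K B : Type*} [Field K] [Ring B] [Algebra K B]

/-- The submodule `V ⊗ 1` of `B ⊗ B`. -/
noncomputable def leftImage (V : Submodule K B) : Submodule K (B ⊗[K] B) :=
  V.map (Algebra.TensorProduct.includeLeft : B →ₐ[K] B ⊗[K] B).toLinearMap

/-- The submodule `1 ⊗ V` of `B ⊗ B`. -/
noncomputable def rightImage (V : Submodule K B) : Submodule K (B ⊗[K] B) :=
  V.map (Algebra.TensorProduct.includeRight : B →ₐ[K] B ⊗[K] B).toLinearMap

theorem leftImage_pow (V : Submodule K B) (n : ℕ) : leftImage (V ^ n) = leftImage V ^ n :=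
  Submodule.map_pow V _ n

theorem rightImage_pow (V : Submodule K B) (n : ℕ) : rightImage (V ^ n) = rightImage V ^ n :=
  Submodule.map_pow V _ n

theorem rightImage_mul (V W : Submodule K B) :
    rightImage (V * W) = rightImage V * rightImage W :=
  Submodule.map_mul V W _

theorem tmul_mem_leftImage_mul_rightImage {V W : Submodule K B} {x y : B}
    (hx : x ∈ V) (hy : y ∈ W) : x ⊗ₜ[K] y ∈ leftImage V * rightImage W := by
  have h : x ⊗ₜ[K] y = (x ⊗ₜ[K] 1) * (1 ⊗ₜ[K] y) := by simp
  rw [h]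
  exact Submodule.mul_mem_mul ⟨x, hx, rfl⟩ ⟨y, hy, rfl⟩

theorem commute_leftImage_rightImage (V W : Submodule K B) :
    Commute (leftImage V) (rightImage W) := by
  refine Submodule.mul_comm_of_commute ?_
  rintro _ ⟨x, -, rfl⟩ _ ⟨y, -, rfl⟩
  simp [Commute, SemiconjBy]

theorem leftImage_mul_rightImage_le_ker {V W : Submodule K B} {φ ψ : B →ₗ[K] K}
    (h : (∀ x ∈ V, φ x = 0) ∨ ∀ y ∈ W, ψ y = 0) :
    leftImage V * rightImage W ≤
      LinearMap.ker (LinearMap.mul' K K ∘ₗ TensorProduct.map φ ψ) := by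
  rw [Submodule.mul_le]
  rintro _ ⟨x, hx, rfl⟩ _ ⟨y, hy, rfl⟩
  rcases h with h | h
  · simp [h x hx]
  · simp [h y hy]

theorem top_mul_ker (p : B →ₐ[K] K) :
    (⊤ : Submodule K B) * LinearMap.ker p.toLinearMap = LinearMap.ker p.toLinearMap := by
  refine le_antisymm (Submodule.mul_le.2 fun x _ y hy => ?_) fun y hy => ?_
  · simp_all
  · simpa using Submodule.mul_mem_mul (Submodule.mem_top (x := (1 : B))) hy

theorem ker_mul_top (p : B →ₐ[K] K) :
    LinearMap.ker p.toLinearMap * (⊤ : Submodule K B) = LinearMap.ker p.toLinearMap := by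
  refine le_antisymm (Submodule.mul_le.2 fun x hx y _ => ?_) fun y hy => ?_
  · simp_all
  · simpa using Submodule.mul_mem_mul hy (Submodule.mem_top (x := (1 : B)))

theorem top_mul_ker_pow (p : B →ₐ[K] K) {n : ℕ} (hn : n ≠ 0) :
    (⊤ : Submodule K B) * LinearMap.ker p.toLinearMap ^ n = LinearMap.ker p.toLinearMap ^ n := by
  obtain ⟨n, rfl⟩ := Nat.exists_eq_succ_of_ne_zero hn
  rw [pow_succ', ← mul_assoc, top_mul_ker]

theorem ker_pow_le_ker_pow (p : B →ₐ[K] K) {m n : ℕ} (hm : m ≠ 0) (hmn : m ≤ n) :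
    LinearMap.ker p.toLinearMap ^ n ≤ LinearMap.ker p.toLinearMap ^ m := by
  obtain ⟨d, rfl⟩ := Nat.exists_eq_add_of_le' hmn
  calc LinearMap.ker p.toLinearMap ^ (d + m)
      = LinearMap.ker p.toLinearMap ^ d * LinearMap.ker p.toLinearMap ^ m := pow_add _ _ _
    _ ≤ ⊤ * LinearMap.ker p.toLinearMap ^ m := mul_le_mul_left le_top _
    _ = LinearMap.ker p.toLinearMap ^ m := top_mul_ker_pow p hm

theorem ker_mul'_comp_map_le (p q : B →ₐ[K] K) :
    LinearMap.ker (LinearMap.mul' K K ∘ₗ TensorProduct.map p.toLinearMap q.toLinearMap) ≤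
      leftImage (LinearMap.ker p.toLinearMap) * rightImage ⊤ +
        rightImage (LinearMap.ker q.toLinearMap) := by
  set J := leftImage (LinearMap.ker p.toLinearMap) * rightImage ⊤ +
    rightImage (LinearMap.ker q.toLinearMap) with hJ
  set f := LinearMap.mul' K K ∘ₗ TensorProduct.map p.toLinearMap q.toLinearMap with hf
  have key (t : B ⊗[K] B) : t - f t • (1 : B ⊗[K] B) ∈ J := by
    induction t with
    | zero => simp
    | add s t hs ht =>
      have h : s + t - f (s + t) • (1 : B ⊗[K] B) = (s - f s • 1) + (t - f t • 1) := by
        rw [map_add, add_smul]; abel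
      rw [h]
      exact J.add_mem hs ht
    | tmul x y =>
      have h : x ⊗ₜ[K] y - f (x ⊗ₜ[K] y) • (1 : B ⊗[K] B) =
          (x - p x • 1) ⊗ₜ[K] y + p x • ((1 : B) ⊗ₜ[K] (y - q y • 1)) := by
        simp [hf, Algebra.TensorProduct.one_def, TensorProduct.sub_tmul, TensorProduct.tmul_sub,
          TensorProduct.smul_tmul', smul_sub, mul_smul]
      rw [h, hJ, Submodule.add_eq_sup]
      refine Submodule.add_mem_sup (tmul_mem_leftImage_mul_rightImage (by simp) trivial)
        (Submodule.smul_mem _ _ ⟨y - q y • 1, by simp, rfl⟩)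
  intro t ht
  simpa [LinearMap.mem_ker.1 ht] using key t

theorem ker_mul'_comp_map_pow_le (p q : B →ₐ[K] K) {a b : ℕ} (ha : a ≠ 0) (hb : b ≠ 0)
    {φ ψ : B →ₗ[K] K} (hφ : ∀ x ∈ LinearMap.ker p.toLinearMap ^ a, φ x = 0)
    (hψ : ∀ x ∈ LinearMap.ker q.toLinearMap ^ b, ψ x = 0) :
    LinearMap.ker (LinearMap.mul' K K ∘ₗ TensorProduct.map p.toLinearMap q.toLinearMap) ^
        (a + b - 1) ≤
      LinearMap.ker (LinearMap.mul' K K ∘ₗ TensorProduct.map φ ψ) := by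
  set P := LinearMap.ker p.toLinearMap
  set Q := LinearMap.ker q.toLinearMap
  have hRQ : Commute (rightImage (⊤ : Submodule K B)) (rightImage Q) := by
    rw [Commute, SemiconjBy, ← rightImage_mul, ← rightImage_mul, top_mul_ker, ker_mul_top]
  have hcomm : Commute (leftImage P * rightImage ⊤) (rightImage Q) :=
    (commute_leftImage_rightImage P Q).mul_left hRQ
  refine (pow_le_pow_left' (ker_mul'_comp_map_le p q) _).trans ?_
  rw [hcomm.add_pow]
  refine Finset.sum_induction _ (· ≤ _) (fun _ _ h₁ h₂ => sup_le h₁ h₂) bot_le fun m hm => ?_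
  have hterm : (leftImage P * rightImage ⊤) ^ m * rightImage Q ^ (a + b - 1 - m) ≤
      LinearMap.ker (LinearMap.mul' K K ∘ₗ TensorProduct.map φ ψ) := by
    rw [(commute_leftImage_rightImage P ⊤).mul_pow, mul_assoc, ← leftImage_pow,
      ← rightImage_pow, ← rightImage_pow, ← rightImage_mul]
    apply leftImage_mul_rightImage_le_ker
    rcases le_or_gt a m with h | h
    · exact Or.inl fun x hx => hφ x (ker_pow_le_ker_pow p ha h hx)
    · refine Or.inr fun y hy => hψ y (ker_pow_le_ker_pow q hb (by omega : b ≤ a + b - 1 - m) ?_)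
      rw [← top_mul_ker_pow q (by omega)]
      exact mul_le_mul_left (α := Submodule K B) le_top _ hy
  rw [← nsmul_eq_mul']
  generalize (a + b - 1).choose m = c
  induction c with
  | zero => rw [zero_nsmul]; exact bot_le
  | succ c ih => rw [succ_nsmul]; exact sup_le ih hterm

end TensorSquare

/-- If `φ` vanishes on `(ker p)^a` and `ψ` vanishes on `(ker q)^b` (`a, b ≥ 1`), then
`φ ⋆ ψ` vanishes on `(ker (p ⋆ q))^{a+b-1}`, where `p ⋆ q` is the algebra homomorphism
whose underlying linear map is the convolution of `p` and `q`. -/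
theorem convolution_of_distributions_supported_at_product_point
    (p q : A →ₐ[k] k) (r : A →ₐ[k] k)
    (hr : r.toLinearMap = convMul p.toLinearMap q.toLinearMap)
    (a b : ℕ) (ha : 1 ≤ a) (hb : 1 ≤ b)
    (φ ψ : A →ₗ[k] k)
    (hφ : ∀ x ∈ (LinearMap.ker p.toLinearMap : Submodule k A) ^ a, φ x = 0)
    (hψ : ∀ x ∈ (LinearMap.ker q.toLinearMap : Submodule k A) ^ b, ψ x = 0) :
    ∀ x ∈ (LinearMap.ker r.toLinearMap : Submodule k A) ^ (a + b - 1),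
      convMul φ ψ x = 0 := by
  have hle : LinearMap.ker r.toLinearMap ≤
      (LinearMap.ker (LinearMap.mul' k k ∘ₗ
        TensorProduct.map p.toLinearMap q.toLinearMap)).comap
        (Bialgebra.comulAlgHom k A).toLinearMap := fun x hx => by
    rwa [hr] at hx
  intro x hx
  have hmem := Submodule.mem_map_of_mem (f := (Bialgebra.comulAlgHom k A).toLinearMap) hx
  rw [Submodule.map_pow] at hmem
  exact ker_mul'_comp_map_pow_le p q (by omega) (by omega) hφ hψ
    (pow_le_pow_left' (Submodule.map_le_iff_le_comap.2 hle) _ hmem)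
end

section
/- Let n, m ∈ ℕ, let R be the subring of the ring of germs at 0 of ℂ-valued functions on ℂⁿ consisting of germs of functions analytic at 0, with I₀ ⊆ R the ideal of analytic germs vanishing at 0, and let A := R ⊗_ℂ Λ, where Λ is the exterior algebra of ℂ^m over ℂ. Let J₀ be the two-sided ideal of A generated by the elements r ⊗ 1 with r ∈ I₀ together with the elements 1 ⊗ ι(v) for v ∈ ℂ^m (ι the canonical inclusion of ℂ^m into its exterior algebra). Then for every integer p ≥ 0 the quotient A / J₀^p is a finite-dimensional ℂ-vector space. -/
open Filter Topology
open scoped TensorProduct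

/-- The subring of the ring of germs at `0` of `ℂ`-valued functions on `ℂⁿ` consisting of
germs of functions analytic at `0`. -/
noncomputable def analyticGerms (n : ℕ) :
    Subring (Filter.Germ (𝓝 (0 : Fin n → ℂ)) ℂ) where
  carrier := {φ | ∃ f : (Fin n → ℂ) → ℂ, AnalyticAt ℂ f 0 ∧ φ = ↑f}
  zero_mem' := ⟨fun _ => 0, analyticAt_const, rfl⟩
  one_mem' := ⟨fun _ => 1, analyticAt_const, rfl⟩
  add_mem' := by
    rintro a b ⟨f, hf, rfl⟩ ⟨g, hg, rfl⟩
    exact ⟨fun x => f x + g x, hf.add hg, rfl⟩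
  neg_mem' := by
    rintro a ⟨f, hf, rfl⟩
    exact ⟨fun x => -f x, hf.neg, rfl⟩
  mul_mem' := by
    rintro a b ⟨f, hf, rfl⟩ ⟨g, hg, rfl⟩
    exact ⟨fun x => f x * g x, hf.mul hg, rfl⟩

/-- Evaluation at `0` of an analytic germ at `0`, as a ring homomorphism. -/
noncomputable def evalAtZero (n : ℕ) : analyticGerms n →+* ℂ where
  toFun φ := Filter.Germ.liftOn φ.1 (fun f => f 0) fun _ _ H => H.eq_of_nhds
  map_one' := rfl
  map_zero' := rfl
  map_mul' φ ψ := by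
    obtain ⟨f, hf, hφ⟩ := φ.2
    obtain ⟨g, hg, hψ⟩ := ψ.2
    have h1 : (φ * ψ : analyticGerms n).1 = ((fun x => f x * g x : (Fin n → ℂ) → ℂ) :
        Filter.Germ (𝓝 (0 : Fin n → ℂ)) ℂ) := by
      show (φ.1 * ψ.1) = _
      rw [hφ, hψ]; rfl
    show Filter.Germ.liftOn (φ * ψ : analyticGerms n).1 _ _ =
      Filter.Germ.liftOn φ.1 (fun f => f 0) (fun _ _ H => H.eq_of_nhds) *
        Filter.Germ.liftOn ψ.1 (fun f => f 0) (fun _ _ H => H.eq_of_nhds)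
    rw [h1, hφ, hψ]
    rfl
  map_add' φ ψ := by
    obtain ⟨f, hf, hφ⟩ := φ.2
    obtain ⟨g, hg, hψ⟩ := ψ.2
    have h1 : (φ + ψ : analyticGerms n).1 = ((fun x => f x + g x : (Fin n → ℂ) → ℂ) :
        Filter.Germ (𝓝 (0 : Fin n → ℂ)) ℂ) := by
      show (φ.1 + ψ.1) = _
      rw [hφ, hψ]; rfl
    show Filter.Germ.liftOn (φ + ψ : analyticGerms n).1 _ _ =
      Filter.Germ.liftOn φ.1 (fun f => f 0) (fun _ _ H => H.eq_of_nhds) +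
        Filter.Germ.liftOn ψ.1 (fun f => f 0) (fun _ _ H => H.eq_of_nhds)
    rw [h1, hφ, hψ]
    rfl

/-- The constant germs, as a ring homomorphism `ℂ →+* analyticGerms n`. -/
noncomputable def constGerm (n : ℕ) : ℂ →+* analyticGerms n where
  toFun c := ⟨((fun _ => c : (Fin n → ℂ) → ℂ) : Filter.Germ (𝓝 (0 : Fin n → ℂ)) ℂ),
    ⟨fun _ => c, analyticAt_const, rfl⟩⟩
  map_one' := rfl
  map_zero' := rfl
  map_mul' _ _ := rfl
  map_add' _ _ := rfl

noncomputable instance (n : ℕ) : Algebra ℂ (analyticGerms n) := (constGerm n).toAlgebra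

/-- The ideal of analytic germs at `0` vanishing at `0`. -/
noncomputable def vanishingIdeal (n : ℕ) : Ideal (analyticGerms n) :=
  RingHom.ker (evalAtZero n)

/-- The stalk at the origin of the structure sheaf of the analytic supermanifold
`ℂ^{n|m}`: analytic germs at `0 ∈ ℂⁿ` tensored with the exterior algebra of `ℂᵐ`. -/
noncomputable abbrev SuperStalk (n m : ℕ) : Type :=
  analyticGerms n ⊗[ℂ] ExteriorAlgebra ℂ (Fin m → ℂ)

/-- The product of two two-sided ideals: the two-sided ideal generated by products. -/
noncomputable def tsiMul {A : Type*} [Ring A] (I J : TwoSidedIdeal A) : TwoSidedIdeal A :=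
  TwoSidedIdeal.span {x | ∃ a ∈ I, ∃ b ∈ J, x = a * b}

/-- Powers of a two-sided ideal. -/
noncomputable def tsiPow {A : Type*} [Ring A] (I : TwoSidedIdeal A) : ℕ → TwoSidedIdeal A
  | 0 => ⊤
  | 1 => I
  | (p + 2) => tsiMul (tsiPow I (p + 1)) I

/-- The underlying `ℂ`-submodule of a two-sided ideal in a `ℂ`-algebra. -/
noncomputable def tsiToSubmodule {A : Type*} [Ring A] [Algebra ℂ A]
    (J : TwoSidedIdeal A) : Submodule ℂ A where
  carrier := J
  zero_mem' := J.zero_mem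
  add_mem' := fun ha hb => J.add_mem ha hb
  smul_mem' := fun c x hx => by
    rw [Algebra.smul_def]
    exact J.mul_mem_left _ _ hx

/-- The maximal two-sided ideal of the stalk of `ℂ^{n|m}` at the origin: the two-sided
ideal generated by the `r ⊗ 1` with `r` an analytic germ vanishing at `0`, together with
the `1 ⊗ ι v` for `v ∈ ℂᵐ`. -/
noncomputable def superVanishingIdeal (n m : ℕ) : TwoSidedIdeal (SuperStalk n m) :=
  TwoSidedIdeal.span
    ({x | ∃ r ∈ vanishingIdeal n, x = r ⊗ₜ[ℂ] (1 : ExteriorAlgebra ℂ (Fin m → ℂ))} ∪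
     {x | ∃ v : Fin m → ℂ, x = (1 : analyticGerms n) ⊗ₜ[ℂ] ExteriorAlgebra.ι ℂ v})

section Hadamard

variable {𝕜 E F : Type*} [NontriviallyNormedField 𝕜] [NormedAddCommGroup E] [NormedSpace 𝕜 E]
  [NormedAddCommGroup F] [NormedSpace 𝕜 F]

theorem FormalMultilinearSeries.shift_apply_const (p : FormalMultilinearSeries 𝕜 E F) (n : ℕ)
    (y : E) : (p.shift n fun _ => y) y = p (n + 1) fun _ => y := by
  refine (ContinuousMultilinearMap.curryRight_apply (p (n + 1)) (fun _ => y) y).trans ?_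
  congr 1
  ext i
  refine Fin.lastCases ?_ (fun j => ?_) i <;> simp

theorem HasFPowerSeriesOnBall.eventuallyEq_add_clm_apply {f : E → F} {G : E → E →L[𝕜] F}
    {p : FormalMultilinearSeries 𝕜 E F} {r r' : ENNReal} (hp : HasFPowerSeriesOnBall f p 0 r)
    (hG : HasFPowerSeriesOnBall G p.shift 0 r') : f =ᶠ[𝓝 0] fun y => f 0 + G y y := by
  filter_upwards [Metric.eball_mem_nhds (0 : E) hp.r_pos,
    Metric.eball_mem_nhds (0 : E) hG.r_pos] with y hy hy'
  have h1 := hp.hasSum hy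
  have h2 := (hG.hasSum hy').mapL (ContinuousLinearMap.apply 𝕜 F y)
  simp only [zero_add, ContinuousLinearMap.apply_apply,
    FormalMultilinearSeries.shift_apply_const] at h1 h2
  have h3 := (hasSum_nat_add_iff (f := fun n => p n fun _ => y) 1).1 h2
  rw [h1.unique h3, Finset.sum_range_one, hp.coeff_zero, add_comm]

/-- Hadamard's lemma for analytic functions: an analytic function at `0` is, near `0`, its value
at `0` plus an analytic family of linear maps evaluated at the point. -/
theorem AnalyticAt.exists_eventuallyEq_add_clm_apply [CompleteSpace F] {f : E → F}
    (hf : AnalyticAt 𝕜 f 0) :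
    ∃ G : E → E →L[𝕜] F, AnalyticAt 𝕜 G 0 ∧ f =ᶠ[𝓝 0] fun y => f 0 + G y y := by
  obtain ⟨p, r, hp⟩ := hf
  have hpos : 0 < p.shift.radius := by
    rw [FormalMultilinearSeries.radius_shift]
    exact hp.r_pos.trans_le hp.r_le
  have hG := p.shift.hasFPowerSeriesOnBall hpos
  exact ⟨p.shift.sum, hG.analyticAt, hp.eventuallyEq_add_clm_apply hG⟩

end Hadamard

/-- The germ at `0` of the `i`-th coordinate function. -/
noncomputable def coordGerm (n : ℕ) (i : Fin n) : analyticGerms n :=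
  ⟨((fun x => x i : (Fin n → ℂ) → ℂ) : Filter.Germ (𝓝 (0 : Fin n → ℂ)) ℂ),
    ⟨fun x => x i, (ContinuousLinearMap.proj (R := ℂ) (φ := fun _ : Fin n => ℂ) i).analyticAt 0,
      rfl⟩⟩

theorem coordGerm_mem_vanishingIdeal (n : ℕ) (i : Fin n) :
    coordGerm n i ∈ vanishingIdeal n :=
  show evalAtZero n (coordGerm n i) = 0 from rfl

theorem evalAtZero_algebraMap (n : ℕ) (c : ℂ) :
    evalAtZero n (algebraMap ℂ (analyticGerms n) c) = c := rfl

theorem sub_algebraMap_evalAtZero_mem (n : ℕ) (r : analyticGerms n) :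
    r - algebraMap ℂ (analyticGerms n) (evalAtZero n r) ∈ vanishingIdeal n := by
  rw [vanishingIdeal, RingHom.mem_ker, map_sub, evalAtZero_algebraMap, sub_self]

/-- An analytic germ vanishing at `0` is a combination of the coordinate germs. -/
theorem exists_eq_sum_coordGerm_mul {n : ℕ} {r : analyticGerms n} (hr : r ∈ vanishingIdeal n) :
    ∃ g : Fin n → analyticGerms n, r = ∑ i, coordGerm n i * g i := by
  obtain ⟨_, f, hf, rfl⟩ := r
  have h0 : f 0 = 0 := hr
  obtain ⟨G, hG, hfG⟩ := hf.exists_eventuallyEq_add_clm_apply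
  refine ⟨fun i => ⟨((fun x => G x (Pi.single i 1) : (Fin n → ℂ) → ℂ) :
    Filter.Germ (𝓝 (0 : Fin n → ℂ)) ℂ), _,
    ((ContinuousLinearMap.apply ℂ ℂ (Pi.single i 1 : Fin n → ℂ)).analyticAt _).comp hG, rfl⟩, ?_⟩
  apply Subtype.ext
  rw [AddSubmonoidClass.coe_finsetSum]
  have hsum : (∑ i, ((fun x => x i * G x (Pi.single i 1) : (Fin n → ℂ) → ℂ) :
      Filter.Germ (𝓝 (0 : Fin n → ℂ)) ℂ)) =
      ((∑ i, fun x => x i * G x (Pi.single i 1) : (Fin n → ℂ) → ℂ) :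
        Filter.Germ (𝓝 (0 : Fin n → ℂ)) ℂ) :=
    (map_sum (Filter.Germ.coeAddHom (𝓝 (0 : Fin n → ℂ)))
      (fun i => (fun x => x i * G x (Pi.single i 1) : (Fin n → ℂ) → ℂ)) Finset.univ).symm
  refine Eq.trans (Filter.Germ.coe_eq.2 ?_) hsum.symm
  filter_upwards [hfG] with x hx
  rw [hx, h0, zero_add, Finset.sum_apply]
  conv_lhs => rw [← Finset.univ_sum_single x, map_sum]
  refine Finset.sum_congr rfl fun i _ => ?_
  rw [← smul_eq_mul, ← map_smul, ← Pi.single_smul, smul_eq_mul, mul_one, Finset.univ_sum_single]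

section TwoSidedIdealPowers

variable {A : Type*} [Ring A] [Algebra ℂ A]

theorem mem_tsiToSubmodule {J : TwoSidedIdeal A} {x : A} : x ∈ tsiToSubmodule J ↔ x ∈ J :=
  Iff.rfl

theorem tsiToSubmodule_mul_self_le (J : TwoSidedIdeal A) :
    tsiToSubmodule J * tsiToSubmodule J ≤ tsiToSubmodule J :=
  Submodule.mul_le.2 fun _ _ _ hb => J.mul_mem_left _ _ hb

theorem tsiToSubmodule_pow_le (J : TwoSidedIdeal A) :
    ∀ p : ℕ, tsiToSubmodule J ^ p ≤ tsiToSubmodule (tsiPow J p)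
  | 0 => fun _ _ => trivial
  | 1 => (pow_one _).le
  | p + 2 => by
    rw [pow_succ]
    refine Submodule.mul_le.2 fun a ha b hb => TwoSidedIdeal.subset_span ?_
    exact ⟨a, tsiToSubmodule_pow_le J (p + 1) ha, b, hb, rfl⟩

/-- If the algebra is spanned by `1` and a two-sided ideal `J`, and the generators of `J` lie in
`W + J²` for a subspace `W` of `J`, then `J ⊆ W + J²`. -/
theorem tsiToSubmodule_span_le {s : Set A} {W : Submodule ℂ A}
    (htop : ⊤ ≤ 1 ⊔ tsiToSubmodule (TwoSidedIdeal.span s))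
    (hW : W ≤ tsiToSubmodule (TwoSidedIdeal.span s))
    (hs : s ⊆ (W ⊔ tsiToSubmodule (TwoSidedIdeal.span s) ^ 2 : Submodule ℂ A)) :
    tsiToSubmodule (TwoSidedIdeal.span s) ≤ W ⊔ tsiToSubmodule (TwoSidedIdeal.span s) ^ 2 := by
  set S := tsiToSubmodule (TwoSidedIdeal.span s) with hS
  have hSS : S * S ≤ S := tsiToSubmodule_mul_self_le _
  have hle : W ⊔ S ^ 2 ≤ S := sup_le hW (by rwa [sq])
  have hl : ⊤ * (W ⊔ S ^ 2) ≤ W ⊔ S ^ 2 := by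
    refine (mul_le_mul_left htop _).trans ?_
    rw [Submodule.sup_mul, one_mul]
    refine sup_le le_rfl (le_sup_of_le_right ?_)
    rw [sq S]
    exact mul_le_mul_right (by rwa [← sq]) _
  have hr : (W ⊔ S ^ 2) * ⊤ ≤ W ⊔ S ^ 2 := by
    refine (mul_le_mul_right htop _).trans ?_
    rw [Submodule.mul_sup, mul_one]
    refine sup_le le_rfl (le_sup_of_le_right ?_)
    rw [sq S]
    exact mul_le_mul_left (by rwa [← sq]) _
  intro x hx
  refine TwoSidedIdeal.span_induction (p := fun x _ => x ∈ W ⊔ S ^ 2) (fun x h => hs h)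
    (zero_mem _) (fun x y _ _ => add_mem) (fun x _ => neg_mem)
    (fun a x _ h => hl (Submodule.mul_mem_mul trivial h))
    (fun a x _ h => hr (Submodule.mul_mem_mul h trivial)) hx

/-- In an algebra spanned by `1` and a subspace `S` with `S ⊆ W + S²` for a finite-dimensional
`W ⊆ S`, every power of `S` has a finite-dimensional supplement. -/
theorem exists_fg_sup_pow_eq_top {S W : Submodule ℂ A} (htop : ⊤ ≤ 1 ⊔ S) (hWS : W ≤ S)
    (hW : W.FG) (hS : S ≤ W ⊔ S ^ 2) (p : ℕ) :
    ∃ F : Submodule ℂ A, F.FG ∧ F ⊔ S ^ (p + 1) = ⊤ := by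
  have key : ∀ p : ℕ, S ^ (p + 1) ≤ W ^ (p + 1) ⊔ S ^ (p + 2) := by
    intro p
    induction p with
    | zero => simpa using hS
    | succ p ih =>
      calc S ^ (p + 1 + 1) = S ^ (p + 1) * S := pow_succ _ _
        _ ≤ (W ^ (p + 1) ⊔ S ^ (p + 2)) * S := mul_le_mul_left ih _
        _ = W ^ (p + 1) * S ⊔ S ^ (p + 1 + 2) := by rw [Submodule.sup_mul, ← pow_succ S]
        _ ≤ W ^ (p + 1) * (W ⊔ S ^ 2) ⊔ S ^ (p + 1 + 2) :=
          sup_le_sup_right (mul_le_mul_right hS _) _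
        _ = W ^ (p + 1 + 1) ⊔ W ^ (p + 1) * S ^ 2 ⊔ S ^ (p + 1 + 2) := by
          rw [Submodule.mul_sup, ← pow_succ]
        _ ≤ W ^ (p + 1 + 1) ⊔ S ^ (p + 1 + 2) := by
          refine sup_le (sup_le le_sup_left (le_sup_of_le_right ?_)) le_sup_right
          rw [pow_add S (p + 1) 2]
          exact mul_le_mul_left (pow_le_pow_left' hWS _) _
  induction p with
  | zero =>
    exact ⟨1, Submodule.one_eq_span (R := ℂ) (A := A) ▸ Submodule.fg_span_singleton 1,
      top_le_iff.1 (by simpa using htop)⟩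
  | succ p ih =>
    obtain ⟨F, hF, hFS⟩ := ih
    refine ⟨F ⊔ W ^ (p + 1), hF.sup (hW.pow _), top_le_iff.1 ?_⟩
    rw [← hFS, sup_assoc]
    exact sup_le_sup_left (key p) F

end TwoSidedIdealPowers

theorem finiteDimensional_quotient_of_fg_sup_eq_top {K V : Type*} [Field K] [AddCommGroup V]
    [Module K V] {F S : Submodule K V} (hF : F.FG) (h : F ⊔ S = ⊤) :
    FiniteDimensional K (V ⧸ S) := by
  refine Module.finite_def.2 ?_
  have : F.map S.mkQ = ⊤ := by
    rw [← Submodule.range_mkQ S, LinearMap.range_eq_map, ← h, Submodule.map_sup,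
      Submodule.mkQ_map_self, sup_bot_eq]
  exact this ▸ hF.map _

section SuperStalk

variable (n m : ℕ)

theorem tmul_one_mem_superVanishingIdeal {r : analyticGerms n} (hr : r ∈ vanishingIdeal n) :
    r ⊗ₜ[ℂ] (1 : ExteriorAlgebra ℂ (Fin m → ℂ)) ∈ superVanishingIdeal n m :=
  TwoSidedIdeal.subset_span (Or.inl ⟨r, hr, rfl⟩)

theorem one_tmul_ι_mem_superVanishingIdeal (v : Fin m → ℂ) :
    (1 : analyticGerms n) ⊗ₜ[ℂ] ExteriorAlgebra.ι ℂ v ∈ superVanishingIdeal n m :=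
  TwoSidedIdeal.subset_span (Or.inr ⟨v, rfl⟩)

theorem one_sup_superVanishingIdeal :
    (⊤ : Submodule ℂ (SuperStalk n m)) ≤ 1 ⊔ tsiToSubmodule (superVanishingIdeal n m) := by
  set S := tsiToSubmodule (superVanishingIdeal n m) with hS
  have hmul : (1 ⊔ S) * (1 ⊔ S) ≤ 1 ⊔ S := by
    rw [Submodule.sup_mul, one_mul, Submodule.mul_sup, mul_one]
    exact sup_le le_rfl (sup_le le_sup_right
      (le_sup_of_le_right (tsiToSubmodule_mul_self_le _)))
  have hR (r : analyticGerms n) : r ⊗ₜ[ℂ] (1 : ExteriorAlgebra ℂ (Fin m → ℂ)) ∈ 1 ⊔ S := by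
    rw [← add_sub_cancel (algebraMap ℂ (analyticGerms n) (evalAtZero n r)) r, TensorProduct.add_tmul]
    refine add_mem (Submodule.mem_sup_left ?_) (Submodule.mem_sup_right ?_)
    · exact Submodule.mem_one.2 ⟨evalAtZero n r, rfl⟩
    · exact tmul_one_mem_superVanishingIdeal n m (sub_algebraMap_evalAtZero_mem n r)
  have hE (a : ExteriorAlgebra ℂ (Fin m → ℂ)) : (1 : analyticGerms n) ⊗ₜ[ℂ] a ∈ 1 ⊔ S := by
    induction a using ExteriorAlgebra.induction with
    | algebraMap c =>
      refine Submodule.mem_sup_left (Submodule.mem_one.2 ⟨c, ?_⟩)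
      rw [Algebra.TensorProduct.algebraMap_apply']
    | ι v => exact Submodule.mem_sup_right (one_tmul_ι_mem_superVanishingIdeal n m v)
    | mul a b ha hb =>
      have := hmul (Submodule.mul_mem_mul ha hb)
      rwa [Algebra.TensorProduct.tmul_mul_tmul, one_mul] at this
    | add a b ha hb => rw [TensorProduct.tmul_add]; exact add_mem ha hb
  intro x _
  induction x using TensorProduct.induction_on with
  | zero => exact zero_mem _
  | tmul r a =>
    have := hmul (Submodule.mul_mem_mul (hR r) (hE a))
    rwa [Algebra.TensorProduct.tmul_mul_tmul, one_mul, mul_one] at this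
  | add x y hx hy => exact add_mem (hx trivial) (hy trivial)

/-- The span of the even and odd coordinates in the stalk of `ℂ^{n|m}` at the origin. -/
noncomputable def coordinateSpan : Submodule ℂ (SuperStalk n m) :=
  Submodule.span ℂ (Set.range fun i =>
    coordGerm n i ⊗ₜ[ℂ] (1 : ExteriorAlgebra ℂ (Fin m → ℂ))) ⊔
  LinearMap.range (TensorProduct.mk ℂ (analyticGerms n) (ExteriorAlgebra ℂ (Fin m → ℂ)) 1 ∘ₗ
    ExteriorAlgebra.ι ℂ)

theorem coordinateSpan_fg : (coordinateSpan n m).FG :=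
  (Submodule.fg_span (Set.finite_range _)).sup (Module.Finite.iff_fg.1 inferInstance)

theorem coordinateSpan_le :
    coordinateSpan n m ≤ tsiToSubmodule (superVanishingIdeal n m) := by
  refine sup_le (Submodule.span_le.2 ?_) ?_
  · rintro _ ⟨i, rfl⟩
    exact tmul_one_mem_superVanishingIdeal n m (coordGerm_mem_vanishingIdeal n i)
  · rintro _ ⟨v, rfl⟩
    exact one_tmul_ι_mem_superVanishingIdeal n m v

theorem superVanishingIdeal_le_coordinateSpan_sup_sq :
    tsiToSubmodule (superVanishingIdeal n m) ≤
      coordinateSpan n m ⊔ tsiToSubmodule (superVanishingIdeal n m) ^ 2 := by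
  refine tsiToSubmodule_span_le (one_sup_superVanishingIdeal n m) (coordinateSpan_le n m) ?_
  rintro _ (⟨r, hr, rfl⟩ | ⟨v, rfl⟩)
  · obtain ⟨g, rfl⟩ := exists_eq_sum_coordGerm_mul hr
    rw [TensorProduct.sum_tmul]
    refine sum_mem fun i _ => ?_
    rw [← add_sub_cancel (algebraMap ℂ (analyticGerms n) (evalAtZero n (g i))) (g i), mul_add,
      TensorProduct.add_tmul]
    refine add_mem (Submodule.mem_sup_left (Submodule.mem_sup_left ?_))
      (Submodule.mem_sup_right ?_)
    · rw [mul_comm, ← Algebra.smul_def, ← TensorProduct.smul_tmul']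
      exact Submodule.smul_mem _ _ (Submodule.subset_span ⟨i, rfl⟩)
    · have := Submodule.mul_mem_mul
        (mem_tsiToSubmodule.2 (tmul_one_mem_superVanishingIdeal n m
          (coordGerm_mem_vanishingIdeal n i)))
        (mem_tsiToSubmodule.2 (tmul_one_mem_superVanishingIdeal n m
          (sub_algebraMap_evalAtZero_mem n (g i))))
      rwa [Algebra.TensorProduct.tmul_mul_tmul, one_mul, ← sq] at this
  · exact Submodule.mem_sup_left (Submodule.mem_sup_right ⟨v, rfl⟩)

end SuperStalk

/-- Every power of the maximal two-sided ideal of the stalk at the origin of `ℂ^{n|m}`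
has finite codimension: the quotient is a finite-dimensional `ℂ`-vector space. -/
theorem superStalk_quotient_pow_finiteDimensional (n m : ℕ) :
    ∀ p : ℕ, FiniteDimensional ℂ
      (SuperStalk n m ⧸ tsiToSubmodule (tsiPow (superVanishingIdeal n m) p)) := by
  rintro (_ | p)
  · exact finiteDimensional_quotient_of_fg_sup_eq_top Submodule.fg_bot
      (top_le_iff.1 fun _ _ => Submodule.mem_sup_right trivial)
  · obtain ⟨F, hF, h⟩ := exists_fg_sup_pow_eq_top (one_sup_superVanishingIdeal n m)
      (coordinateSpan_le n m) (coordinateSpan_fg n m)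
      (superVanishingIdeal_le_coordinateSpan_sup_sq n m) p
    exact finiteDimensional_quotient_of_fg_sup_eq_top hF
      (top_le_iff.1 (h ▸ sup_le_sup_left (tsiToSubmodule_pow_le _ _) F))
end
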